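/- arXiv:1711.03493 — 2 statements merged into one kernel-verified Lean document; each statement's English description precedes it below -/
import Mathlib

section
/- For positive real numbers x_1,...,x_n and positive weights λ_1,...,λ_n with partial sums Λ_k = λ_1+...+λ_k, if the sequence (λ_i/Λ_i)_{i=1}^n is nonincreasing, then ∏_{i=1}^n (∑_{j=1}^i (λ_j/Λ_i) x_j)^{λ_i/Λ_n} ≥ ∑_{j=1}^n (λ_j/Λ_n) ∏_{i=1}^j x_i^{λ_i/Λ_j}. -/
open Finset

namespace KedAux

noncomputable def dd (lam L : ℕ → ℝ) (m k : ℕ) : ℝ := L (k - 1) * lam (m + 1) / (lam k * L m)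

noncomputable def Y (lam L f : ℕ → ℝ) : ℕ → ℕ → ℕ → ℝ
  | 0, _, _ => 0
  | m + 1, i, k => if i = m + 1 then f k else
      (1 - dd lam L m k) * Y lam L f m i k + dd lam L m k * Y lam L f m i (k - 1)

structure Hyp (N : ℕ) (lam L : ℕ → ℝ) : Prop where
  pos : ∀ k, 1 ≤ k → k ≤ N → 0 < lam k
  L0 : L 0 = 0
  Ls : ∀ k, L (k + 1) = L k + lam (k + 1)
  mono : ∀ k, 1 ≤ k → k + 1 ≤ N → lam (k + 1) / L (k + 1) ≤ lam k / L k

variable {N : ℕ} {lam L : ℕ → ℝ}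

lemma Hyp.nonneg (h : Hyp N lam L) : ∀ k, k ≤ N → 0 ≤ L k := by
  intro k
  induction k with
  | zero => intro _; rw [h.L0]
  | succ k ih =>
    intro hk
    rw [h.Ls]
    have := ih (by omega)
    have := h.pos (k + 1) (by omega) hk
    linarith

lemma Hyp.Lpos (h : Hyp N lam L) (k : ℕ) (h1 : 1 ≤ k) (hk : k ≤ N) : 0 < L k := by
  obtain ⟨k, rfl⟩ : ∃ j, k = j + 1 := ⟨k - 1, by omega⟩
  rw [h.Ls]
  have := h.nonneg k (by omega)
  have := h.pos (k + 1) (by omega) hk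
  linarith

lemma Hyp.anti (h : Hyp N lam L) (j k : ℕ) (h1 : 1 ≤ j) (hjk : j ≤ k) (hk : k ≤ N) :
    lam k / L k ≤ lam j / L j := by
  induction k, hjk using Nat.le_induction with
  | base => exact le_rfl
  | succ k hk' ih => exact (h.mono k (by omega) hk).trans (ih (by omega))

lemma Hyp.d_nonneg (h : Hyp N lam L) (m k : ℕ) (hm : m + 1 ≤ N) (h1 : 1 ≤ k) (hk : k ≤ m + 1) :
    0 ≤ dd lam L m k := by
  have := h.nonneg (k - 1) (by omega)
  have := h.nonneg m (by omega)
  have := h.pos (m + 1) (by omega) hm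
  have := h.pos k (by omega) (by omega)
  unfold dd
  positivity

lemma Hyp.d_le (h : Hyp N lam L) (m k : ℕ) (hm0 : 1 ≤ m) (hm : m + 1 ≤ N) (h1 : 1 ≤ k)
    (hk : k ≤ m + 1) : dd lam L m k ≤ 1 := by
  have a1 := h.Lpos m hm0 (by omega)
  have a2 := h.pos k (by omega) (by omega)
  have a3 := h.anti k (m + 1) h1 hk hm
  have a4 := h.Lpos k h1 (by omega)
  have a5 := h.Lpos (m + 1) (by omega) hm
  rw [div_le_div_iff₀ a5 a4, h.Ls m] at a3
  have a6 : L k = L (k - 1) + lam k := by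
    obtain ⟨k, rfl⟩ : ∃ j, k = j + 1 := ⟨k - 1, by omega⟩
    exact h.Ls k
  rw [a6] at a3
  unfold dd
  rw [div_le_one (by positivity)]
  nlinarith

lemma Hyp.d_one (h : Hyp N lam L) (m : ℕ) : dd lam L m 1 = 0 := by
  simp [dd, h.L0]

lemma Hyp.d_top (h : Hyp N lam L) (m : ℕ) (hm0 : 1 ≤ m) (hm : m + 1 ≤ N) :
    dd lam L m (m + 1) = 1 := by
  have a1 := h.Lpos m hm0 (by omega)
  have a2 := h.pos (m + 1) (by omega) (by omega)
  simp only [dd, Nat.add_sub_cancel]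
  field_simp

lemma Hyp.jensen (h : Hyp N lam L) (x : ℕ → ℝ) (hx : ∀ k, 1 ≤ k → k ≤ N → 0 < x k) (n : ℕ) :
    n ≤ N → ∀ i k, 1 ≤ i → i ≤ n → 1 ≤ k → k ≤ n →
      0 < Y lam L x n i k ∧
        Y lam L (fun j => Real.log (x j)) n i k ≤ Real.log (Y lam L x n i k) := by
  induction n with
  | zero => intro _ i k; omega
  | succ m ih =>
    intro hm i k hi1 hi hk1 hk
    by_cases him : i = m + 1
    · simp only [Y, him, if_true]
      exact ⟨hx k hk1 (by omega), le_rfl⟩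
    simp only [Y, him, if_false]
    have ih := ih (by omega)
    by_cases hk' : k = 1
    · subst hk'
      rw [h.d_one]
      simpa using ih i 1 hi1 (by omega) (by omega) (by omega)
    by_cases hk2 : k = m + 1
    · subst hk2
      rw [h.d_top m (by omega) hm]
      simpa using ih i m hi1 (by omega) (by omega) (by omega)
    obtain ⟨p1, q1⟩ := ih i k hi1 (by omega) (by omega) (by omega)
    obtain ⟨p2, q2⟩ := ih i (k - 1) hi1 (by omega) (by omega) (by omega)
    have d0 := h.d_nonneg m k hm hk1 hk
    have d1 := h.d_le m k (by omega) hm hk1 hk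
    generalize dd lam L m k = d at *
    have c := strictConcaveOn_log_Ioi.concaveOn.2 (Set.mem_Ioi.2 p1) (Set.mem_Ioi.2 p2)
      (sub_nonneg.2 d1) d0 (by ring)
    simp only [smul_eq_mul] at c
    constructor
    · rcases d0.eq_or_lt with e | e
      · rw [← e]; simpa using p1
      · have := mul_pos e p2
        have := mul_nonneg (sub_nonneg.2 d1) p1.le
        linarith
    · refine le_trans ?_ c
      have := sub_nonneg.2 d1
      gcongr

lemma Hyp.abel (h : Hyp N lam L) (g : ℕ → ℝ) (c : ℝ) (M : ℕ) :
    M ≤ N → ∀ m, L m ≠ 0 → c * L m = lam (m + 1) →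
    ∑ k ∈ Icc 1 M, lam k * ((1 - dd lam L m k) * g k + dd lam L m k * g (k - 1)) =
     (1 + c) * ∑ k ∈ Icc 1 M, lam k * g k - c * L M * g M := by
  intro hM m hLm hc
  induction M with
  | zero => simp [h.L0]
  | succ M ih =>
    rw [sum_Icc_succ_top (by omega), sum_Icc_succ_top (by omega), ih (by omega), h.Ls M]
    have a2 := h.pos (M + 1) (by omega) (by omega)
    have key : lam (M + 1) * dd lam L m (M + 1) = c * L M := by
      simp only [dd, Nat.add_sub_cancel, ← hc]
      field_simp
    simp only [Nat.add_sub_cancel]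
    linear_combination (g M - g (M + 1)) * key

lemma Hyp.A (h : Hyp N lam L) (f : ℕ → ℝ) (n : ℕ) :
    n ≤ N → ∀ i, 1 ≤ i → i ≤ n →
      ∑ k ∈ Icc 1 n, lam k * Y lam L f n i k = L n * ((∑ j ∈ Icc 1 i, lam j * f j) / L i) := by
  induction n with
  | zero => intro _ i; omega
  | succ m ih =>
    intro hm i hi1 hi
    have a5 := h.Lpos (m + 1) (by omega) hm
    by_cases him : i = m + 1
    · subst him
      simp only [Y, if_true]
      field_simp
    simp only [Y, him, if_false]
    have a1 := h.Lpos m (by omega) (by omega)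
    have hc : lam (m + 1) / L m * L m = lam (m + 1) := by field_simp
    rw [h.abel _ (lam (m + 1) / L m) (m + 1) hm m a1.ne' hc, sum_Icc_succ_top (by omega),
      ih (by omega) i hi1 (by omega), h.Ls m]
    field_simp
    ring

lemma Hyp.B (h : Hyp N lam L) (f : ℕ → ℝ) (n : ℕ) :
    n ≤ N → ∀ k, 1 ≤ k → k ≤ n →
      ∑ i ∈ Icc 1 n, lam i * Y lam L f n i k = L n * ((∑ j ∈ Icc 1 k, lam j * f j) / L k) := by
  induction n with
  | zero => intro _ i; omega
  | succ m ih =>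
    intro hm k hk1 hk
    have a5 := h.Lpos (m + 1) (by omega) hm
    have ih := ih (by omega)
    have e : ∑ i ∈ Icc 1 (m + 1), lam i * Y lam L f (m + 1) i k =
        (1 - dd lam L m k) * ∑ i ∈ Icc 1 m, lam i * Y lam L f m i k
        + dd lam L m k * ∑ i ∈ Icc 1 m, lam i * Y lam L f m i (k - 1) + lam (m + 1) * f k := by
      rw [sum_Icc_succ_top (by omega), mul_sum, mul_sum, ← sum_add_distrib]
      congr 1
      · refine sum_congr rfl fun i hi => ?_
        have : i ≠ m + 1 := by have := mem_Icc.1 hi; omega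
        simp only [Y, this, if_false]
        ring
      · simp [Y]
    rw [e]
    by_cases hm0 : m = 0
    · subst hm0
      obtain rfl : k = 1 := by omega
      have : L (0 + 1) ≠ 0 := a5.ne'
      simp at this ⊢
      field_simp
    have a1 := h.Lpos m (by omega) (by omega)
    by_cases hk' : k = 1
    · subst hk'
      have b1 : L 1 = lam 1 := by have := h.Ls 0; simpa [h.L0] using this
      have b2 := h.pos 1 (by omega) (by omega)
      rw [h.d_one, ih 1 (by omega) (by omega), h.Ls m]
      simp [b1]
      field_simp
    obtain ⟨k, rfl⟩ : ∃ j, k = j + 1 := ⟨k - 1, by omega⟩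
    have c1 := h.Lpos k (by omega) (by omega)
    have c2 := h.Lpos (k + 1) (by omega) (by omega)
    have c3 := h.pos (k + 1) (by omega) (by omega)
    have c4 := h.Ls k
    have c5 := h.Ls m
    by_cases hk2 : k = m
    · subst hk2
      rw [h.d_top k (by omega) hm, Nat.add_sub_cancel, ih k (by omega) (by omega),
        sum_Icc_succ_top (by omega)]
      field_simp
      ring
    rw [Nat.add_sub_cancel, ih k (by omega) (by omega), ih (k + 1) (by omega) (by omega),
        sum_Icc_succ_top (by omega), c5]
    simp only [dd, Nat.add_sub_cancel]
    rw [c4] at c2 ⊢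
    field_simp
    ring

end KedAux

open KedAux in
/-- Kedlaya's 1999 weighted inequality: if the ratio sequence `λ i / Λ i` is
nonincreasing, then the weighted geometric mean of the weighted arithmetic
partial means dominates the weighted arithmetic mean of the weighted geometric
partial means. -/
theorem weighted_kedlaya_geometric
    (n : ℕ) (hn : 1 ≤ n) (x lam : ℕ → ℝ)
    (hx : ∀ i ∈ Icc 1 n, 0 < x i)
    (hlam : ∀ i ∈ Icc 1 n, 0 < lam i)
    (L : ℕ → ℝ) (hL : ∀ k, L k = ∑ j ∈ Icc 1 k, lam j)
    (hmono : ∀ i ∈ Icc 1 (n - 1), lam (i + 1) / L (i + 1) ≤ lam i / L i) :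
    ∑ j ∈ Icc 1 n, (lam j / L n) * ∏ i ∈ Icc 1 j, x i ^ (lam i / L j)
      ≤ ∏ i ∈ Icc 1 n, (∑ j ∈ Icc 1 i, (lam j / L i) * x j) ^ (lam i / L n) := by
  have h : Hyp n lam L :=
    { pos := fun k h1 h2 => hlam k (mem_Icc.2 ⟨h1, h2⟩)
      L0 := by simp [hL]
      Ls := fun k => by rw [hL, hL, sum_Icc_succ_top (by omega)]
      mono := fun k h1 h2 => hmono k (mem_Icc.2 ⟨h1, by omega⟩) }
  have hx' : ∀ k, 1 ≤ k → k ≤ n → 0 < x k := fun k h1 h2 => hx k (mem_Icc.2 ⟨h1, h2⟩)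
  have hLn := h.Lpos n hn le_rfl
  set A : ℕ → ℝ := fun i => (∑ j ∈ Icc 1 i, lam j * x j) / L i with hA
  have hAe : ∀ i, ∑ j ∈ Icc 1 i, (lam j / L i) * x j = A i := by
    intro i
    simp only [hA, sum_div]
    exact sum_congr rfl fun j _ => by ring
  simp only [hAe]
  have hApos : ∀ i ∈ Icc 1 n, 0 < A i := by
    intro i hi
    obtain ⟨i1, i2⟩ := mem_Icc.1 hi
    refine div_pos (sum_pos (fun j hj => ?_) ⟨1, by simp; omega⟩) (h.Lpos i i1 i2)
    obtain ⟨j1, j2⟩ := mem_Icc.1 hj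
    exact mul_pos (h.pos j j1 (by omega)) (hx' j j1 (by omega))
  have hFpos : 0 < ∏ i ∈ Icc 1 n, A i ^ (lam i / L n) :=
    prod_pos fun i hi => Real.rpow_pos_of_pos (hApos i hi) _
  have hw : ∑ i ∈ Icc 1 n, lam i / L n = 1 := by
    rw [← sum_div, ← hL, div_self hLn.ne']
  have hwn : ∀ i ∈ Icc 1 n, 0 ≤ lam i / L n := fun i hi => (div_pos (hlam i hi) hLn).le
  have key : ∀ k ∈ Icc 1 n, ∏ i ∈ Icc 1 k, x i ^ (lam i / L k) ≤
      (∏ i ∈ Icc 1 n, A i ^ (lam i / L n)) *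
        ∑ i ∈ Icc 1 n, lam i / L n * (Y lam L x n i k / A i) := by
    intro k hk
    obtain ⟨k1, k2⟩ := mem_Icc.1 hk
    have J := fun i (hi : i ∈ Icc 1 n) =>
      h.jensen x hx' n le_rfl i k (mem_Icc.1 hi).1 (mem_Icc.1 hi).2 k1 k2
    have s1 : ∏ i ∈ Icc 1 k, x i ^ (lam i / L k) ≤
        ∏ i ∈ Icc 1 n, Y lam L x n i k ^ (lam i / L n) := by
      have e1 : ∏ i ∈ Icc 1 k, x i ^ (lam i / L k) =
          Real.exp ((∑ j ∈ Icc 1 k, lam j * Real.log (x j)) / L k) := by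
        rw [sum_div, Real.exp_sum]
        refine prod_congr rfl fun i hi => ?_
        obtain ⟨i1, i2⟩ := mem_Icc.1 hi
        rw [Real.rpow_def_of_pos (hx' i i1 (by omega))]
        congr 1; ring
      have e2 : ∏ i ∈ Icc 1 n, Y lam L x n i k ^ (lam i / L n) =
          Real.exp (∑ i ∈ Icc 1 n, lam i / L n * Real.log (Y lam L x n i k)) := by
        rw [Real.exp_sum]
        refine prod_congr rfl fun i hi => ?_
        rw [Real.rpow_def_of_pos (J i hi).1]
        congr 1; ring
      have e3 := h.B (fun j => Real.log (x j)) n le_rfl k k1 k2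
      rw [e1, e2, Real.exp_le_exp]
      calc _ = ∑ i ∈ Icc 1 n, lam i / L n * Y lam L (fun j => Real.log (x j)) n i k := by
            rw [eq_comm]
            have : ∀ i, lam i / L n * Y lam L (fun j => Real.log (x j)) n i k =
              (lam i * Y lam L (fun j => Real.log (x j)) n i k) / L n := fun i => by ring
            simp only [this]
            rw [← sum_div, e3, mul_div_cancel_left₀ _ hLn.ne']
        _ ≤ _ := sum_le_sum fun i hi => mul_le_mul_of_nonneg_left (J i hi).2 (hwn i hi)
    have s2 := Real.geom_mean_le_arith_mean_weighted (Icc 1 n) (fun i => lam i / L n)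
      (fun i => Y lam L x n i k / A i) hwn hw
      (fun i hi => (div_pos (J i hi).1 (hApos i hi)).le)
    refine s1.trans (le_trans (le_of_eq ?_) (mul_le_mul_of_nonneg_left s2 hFpos.le))
    rw [← prod_mul_distrib]
    refine prod_congr rfl fun i hi => ?_
    rw [← Real.mul_rpow (hApos i hi).le (div_pos (J i hi).1 (hApos i hi)).le,
      mul_div_cancel₀ _ (hApos i hi).ne']
  calc _ ≤ ∑ k ∈ Icc 1 n, (lam k / L n) * ((∏ i ∈ Icc 1 n, A i ^ (lam i / L n)) *
        ∑ i ∈ Icc 1 n, lam i / L n * (Y lam L x n i k / A i)) :=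
        sum_le_sum fun k hk => mul_le_mul_of_nonneg_left (key k hk) (hwn k hk)
    _ = (∏ i ∈ Icc 1 n, A i ^ (lam i / L n)) * ∑ i ∈ Icc 1 n, lam i / L n *
        ((∑ k ∈ Icc 1 n, lam k * Y lam L x n i k) / (L n * A i)) := by
        simp only [mul_sum, sum_div]
        rw [sum_comm]
        refine sum_congr rfl fun i _ => sum_congr rfl fun k _ => ?_
        rw [mul_comm (L n) (A i), ← div_div]
        ring
    _ = (∏ i ∈ Icc 1 n, A i ^ (lam i / L n)) * ∑ i ∈ Icc 1 n, lam i / L n := by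
        congr 1
        refine sum_congr rfl fun i hi => ?_
        rw [h.A x n le_rfl i (mem_Icc.1 hi).1 (mem_Icc.1 hi).2]
        have := mul_pos hLn (hApos i hi)
        rw [div_self this.ne', mul_one]
    _ = _ := by rw [hw, mul_one]
end

section
/- Let n ≥ 2, let λ_1,...,λ_n > 0 with Λ_k = λ_1+...+λ_k and suppose (λ_k/Λ_k) is nonincreasing. Let M be a symmetric, Jensen concave weighted mean on an interval I (over ℝ, continuous in the weights), x ∈ I^n, and m_k = (λ_1x_1+...+λ_kx_k)/Λ_k. Then for every j ∈ {2,...,n}: Λ_{j-1}·M((m_1,...,m_{j-1}),(λ_1,...,λ_{j-1})) + λ_j·M((x_1,...,x_j),(λ_1,...,λ_j)) ≤ Λ_j·M((m_1,...,m_j),(λ_1,...,λ_j)). -/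
open Finset

/-- A weight vector: all entries nonnegative with positive sum. -/
def IsWeightVec (lam : List ℝ) : Prop := (∀ w ∈ lam, 0 ≤ w) ∧ 0 < lam.sum

/-- The shuffle (interleaving) of two lists of equal length. -/
def shuffle {α : Type*} (a b : List α) : List α :=
  (List.zipWith (fun p q => [p, q]) a b).flatten


structure GoodMean (I : Set ℝ) (M : List ℝ → List ℝ → ℝ) : Prop where
  hI : Convex ℝ I
  hhom : ∀ (x lam : List ℝ) (t : ℝ), 0 < t → x.length = lam.length →
      (∀ a ∈ x, a ∈ I) → IsWeightVec lam → M x (lam.map (fun w => t * w)) = M x lam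
  hred : ∀ (x lam mu : List ℝ), x.length = lam.length → x.length = mu.length →
      (∀ a ∈ x, a ∈ I) → IsWeightVec lam → IsWeightVec mu →
      M x (List.zipWith (· + ·) lam mu) = M (shuffle x x) (shuffle lam mu)
  hmean : ∀ (x lam : List ℝ), x ≠ [] → x.length = lam.length →
      (∀ a ∈ x, a ∈ I) → IsWeightVec lam →
      (∃ a ∈ x, a ≤ M x lam) ∧ (∃ a ∈ x, M x lam ≤ a)
  helim : ∀ (x₁ x₂ lam₁ lam₂ : List ℝ) (a : ℝ),
      x₁.length = lam₁.length → x₂.length = lam₂.length →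
      (∀ b ∈ x₁ ++ a :: x₂, b ∈ I) → IsWeightVec (lam₁ ++ 0 :: lam₂) →
      M (x₁ ++ a :: x₂) (lam₁ ++ 0 :: lam₂) = M (x₁ ++ x₂) (lam₁ ++ lam₂)
  hsym : ∀ (x lam x' lam' : List ℝ), x.length = lam.length →
      (∀ a ∈ x, a ∈ I) → IsWeightVec lam →
      (x.zip lam).Perm (x'.zip lam') → M x lam = M x' lam'
  hconc : ∀ (x y lam : List ℝ), x.length = lam.length → y.length = lam.length →
      x ≠ [] → (∀ a ∈ x, a ∈ I) → (∀ a ∈ y, a ∈ I) → IsWeightVec lam →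
      (M x lam + M y lam) / 2 ≤ M (List.zipWith (fun a b => (a + b) / 2) x y) lam

def VV (I : Set ℝ) (S : Multiset (ℝ × ℝ)) : Prop :=
  (∀ p ∈ S, p.1 ∈ I ∧ 0 ≤ p.2) ∧ 0 < (S.map Prod.snd).sum

noncomputable def NN (M : List ℝ → List ℝ → ℝ) (S : Multiset (ℝ × ℝ)) : ℝ :=
  M (S.toList.map Prod.fst) (S.toList.map Prod.snd)

theorem VV.wt {I : Set ℝ} {l : List (ℝ × ℝ)} (h : VV I (l : Multiset (ℝ × ℝ))) :
    IsWeightVec (l.map Prod.snd) := by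
  refine ⟨?_, by simpa [VV] using h.2⟩
  intro w hw
  obtain ⟨p, hp, rfl⟩ := List.mem_map.1 hw
  exact (h.1 p (by simpa using hp)).2

theorem VV.en {I : Set ℝ} {l : List (ℝ × ℝ)} (h : VV I (l : Multiset (ℝ × ℝ))) :
    ∀ a ∈ l.map Prod.fst, a ∈ I := by
  intro w hw
  obtain ⟨p, hp, rfl⟩ := List.mem_map.1 hw
  exact (h.1 p (by simpa using hp)).1

theorem VV.ne {I : Set ℝ} {l : List (ℝ × ℝ)} (h : VV I (l : Multiset (ℝ × ℝ))) :
    l ≠ [] := by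
  rintro rfl
  simp [VV] at h

section
variable {I : Set ℝ} {M : List ℝ → List ℝ → ℝ}

theorem zip_fs (l : List (ℝ × ℝ)) : (l.map Prod.fst).zip (l.map Prod.snd) = l := by
  induction l with
  | nil => rfl
  | cons p l ih => simp [ih]

theorem NN_coe (g : GoodMean I M) (l : List (ℝ × ℝ)) (h : VV I (l : Multiset (ℝ × ℝ))) :
    NN M (l : Multiset (ℝ × ℝ)) = M (l.map Prod.fst) (l.map Prod.snd) := by
  symm
  apply g.hsym _ _ _ _ (by simp) h.en h.wt
  rw [zip_fs, zip_fs]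
  apply Multiset.coe_eq_coe.1
  simp

theorem VV.cons {S : Multiset (ℝ × ℝ)} {y a : ℝ} (h : VV I S) (hy : y ∈ I) (ha : 0 ≤ a) :
    VV I ((y, a) ::ₘ S) := by
  refine ⟨?_, ?_⟩
  · intro p hp
    rcases Multiset.mem_cons.1 hp with rfl | hp
    · exact ⟨hy, ha⟩
    · exact h.1 p hp
  · have := h.2
    simp; linarith

theorem NN_zero (g : GoodMean I M) (S : Multiset (ℝ × ℝ)) (y : ℝ) (h : VV I S) (hy : y ∈ I) :
    NN M ((y, 0) ::ₘ S) = NN M S := by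
  have hc := h.cons hy le_rfl
  induction S using Quotient.inductionOn with
  | h l =>
  simp only [Multiset.quot_mk_to_coe, Multiset.cons_coe] at *
  rw [NN_coe g _ hc, NN_coe g _ h]
  have := g.helim [] (l.map Prod.fst) [] (l.map Prod.snd) y rfl (by simp)
    (by simpa using hc.en) (by simpa using hc.wt)
  simpa using this

theorem VV.addz {S : Multiset (ℝ × ℝ)} (h : VV I S) (T : Multiset ℝ) (hT : ∀ y ∈ T, y ∈ I) :
    VV I (T.map (fun y => (y, (0:ℝ))) + S) := by
  induction T using Multiset.induction_on with
  | empty => simpa using h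
  | cons y T ih =>
    rw [Multiset.map_cons, Multiset.cons_add]
    exact (ih (fun z hz => hT z (by simp [hz]))).cons (hT y (by simp)) le_rfl

theorem NN_zeros (g : GoodMean I M) (S : Multiset (ℝ × ℝ)) (h : VV I S) (T : Multiset ℝ)
    (hT : ∀ y ∈ T, y ∈ I) :
    NN M (T.map (fun y => (y, (0:ℝ))) + S) = NN M S := by
  induction T using Multiset.induction_on with
  | empty => simp
  | cons y T ih =>
    have hT' : ∀ z ∈ T, z ∈ I := fun z hz => hT z (by simp [hz])
    rw [Multiset.map_cons, Multiset.cons_add, NN_zero g _ _ (h.addz T hT') (hT y (by simp)), ih hT']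

def shuf0 (l : List (ℝ × ℝ)) : List (ℝ × ℝ) := l.flatMap (fun p => [p, (p.1, 0)])

theorem shuf0_fst (l : List (ℝ × ℝ)) :
    (shuf0 l).map Prod.fst = shuffle (l.map Prod.fst) (l.map Prod.fst) := by
  induction l with
  | nil => rfl
  | cons p l ih => simpa [shuf0, shuffle] using ih

theorem shuf0_snd (l : List (ℝ × ℝ)) :
    (shuf0 l).map Prod.snd = shuffle (l.map Prod.snd) (l.map (fun _ => (0:ℝ))) := by
  induction l with
  | nil => rfl
  | cons p l ih => simpa [shuf0, shuffle] using ih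

theorem shuf0_coe (l : List (ℝ × ℝ)) :
    ((shuf0 l : List (ℝ × ℝ)) : Multiset (ℝ × ℝ)) =
      ((l : Multiset (ℝ × ℝ)).map Prod.fst).map (fun y => (y, (0:ℝ))) + (l : Multiset (ℝ × ℝ)) := by
  induction l with
  | nil => rfl
  | cons p l ih =>
    have : shuf0 (p :: l) = p :: (p.1, 0) :: shuf0 l := rfl
    rw [this, ← Multiset.cons_coe, ← Multiset.cons_coe, ih, ← Multiset.cons_coe]
    simp only [Multiset.map_cons, Multiset.cons_add, Multiset.add_cons]

theorem NN_split (g : GoodMean I M) (S : Multiset (ℝ × ℝ)) (y a b : ℝ)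
    (ha : 0 ≤ a) (hb : 0 ≤ b) (h : VV I ((y, a + b) ::ₘ S)) :
    NN M ((y, a + b) ::ₘ S) = NN M ((y, a) ::ₘ (y, b) ::ₘ S) := by
  have hy : y ∈ I := (h.1 (y, a+b) (by simp)).1
  rcases ha.eq_or_lt with rfl | ha'
  · rw [zero_add] at *
    rw [NN_zero g _ _ h hy]
  rcases hb.eq_or_lt with rfl | hb'
  · rw [add_zero] at *
    rw [Multiset.cons_swap, NN_zero g _ _ h hy]
  have hS : ∀ p ∈ S, p.1 ∈ I ∧ 0 ≤ p.2 := fun p hp => h.1 p (by simp [hp])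
  have hSs : 0 ≤ (S.map Prod.snd).sum := Multiset.sum_nonneg (by
    intro w hw
    obtain ⟨p, hp, rfl⟩ := Multiset.mem_map.1 hw
    exact (hS p hp).2)
  have h2 : VV I ((y, a) ::ₘ (y, b) ::ₘ S) := by
    refine ⟨?_, by simp; linarith⟩
    intro p hp
    simp only [Multiset.mem_cons] at hp
    rcases hp with rfl | rfl | hp
    · exact ⟨hy, ha⟩
    · exact ⟨hy, hb⟩
    · exact hS p hp
  have hT : ∀ z ∈ S.map Prod.fst, z ∈ I := by
    intro w hw
    obtain ⟨p, hp, rfl⟩ := Multiset.mem_map.1 hw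
    exact (hS p hp).1
  rw [← NN_zeros g _ h2 _ hT]
  have h3 := h2.addz _ hT
  induction S using Quotient.inductionOn with
  | h l =>
  simp only [Multiset.quot_mk_to_coe] at *
  rw [Multiset.add_cons, Multiset.add_cons, ← shuf0_coe] at *
  simp only [Multiset.cons_coe] at *
  rw [NN_coe g _ h, NN_coe g _ h3]
  have := g.hred (y :: l.map Prod.fst) (a :: l.map Prod.snd) (b :: l.map (fun _ => (0:ℝ)))
    (by simp) (by simp) (by simpa using h.en) 
    (by
      refine ⟨?_, ?_⟩
      · have := h2.wt.1
        intro w hw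
        apply this
        simp only [List.map_cons, List.mem_cons] at hw ⊢
        tauto
      · simp at hSs ⊢; linarith)
    (by
      refine ⟨?_, ?_⟩
      · intro w hw
        simp only [List.mem_cons, List.mem_map] at hw
        rcases hw with rfl | ⟨_, _, rfl⟩
        · exact hb
        · exact le_rfl
      · simp; exact hb')
  have e1 : List.zipWith (· + ·) (a :: l.map Prod.snd) (b :: l.map (fun _ => (0:ℝ)))
      = (a + b) :: l.map Prod.snd := by
    rw [List.zipWith_cons_cons]
    congr 1
    clear * -
    induction l with
    | nil => rfl
    | cons p l ih => rw [List.map_cons, List.map_cons, List.zipWith_cons_cons, ih, add_zero]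
  have e2 : shuffle (y :: l.map Prod.fst) (y :: l.map Prod.fst) =
      y :: y :: shuffle (l.map Prod.fst) (l.map Prod.fst) := rfl
  have e3 : shuffle (a :: l.map Prod.snd) (b :: l.map (fun _ => (0:ℝ))) =
      a :: b :: shuffle (l.map Prod.snd) (l.map (fun _ => (0:ℝ))) := rfl
  rw [e1, e2, e3, ← shuf0_fst, ← shuf0_snd] at this
  simpa using this

theorem NN_bdd (g : GoodMean I M) (S : Multiset (ℝ × ℝ)) (h : VV I S) (B : ℝ)
    (hB : ∀ p ∈ S, |p.1| ≤ B) : |NN M S| ≤ B := by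
  induction S using Quotient.inductionOn with
  | h l =>
  simp only [Multiset.quot_mk_to_coe] at *
  rw [NN_coe g _ h]
  obtain ⟨⟨a, ha, ha'⟩, ⟨b, hb, hb'⟩⟩ := g.hmean (l.map Prod.fst) (l.map Prod.snd)
    (by simpa using h.ne) (by simp) h.en h.wt
  obtain ⟨p, hp, rfl⟩ := List.mem_map.1 ha
  obtain ⟨q, hq, rfl⟩ := List.mem_map.1 hb
  have h1 := abs_le.1 (hB p (by simpa using hp))
  have h2 := abs_le.1 (hB q (by simpa using hq))
  exact abs_le.2 ⟨by linarith, by linarith⟩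

theorem NN_mid (g : GoodMean I M) (T : Multiset (ℝ × ℝ × ℝ))
    (h1 : VV I (T.map (fun p => (p.1, p.2.2)))) (h2 : VV I (T.map (fun p => (p.2.1, p.2.2))))
    (h3 : VV I (T.map (fun p => ((p.1 + p.2.1) / 2, p.2.2)))) :
    (NN M (T.map (fun p => (p.1, p.2.2))) + NN M (T.map (fun p => (p.2.1, p.2.2)))) / 2 ≤
      NN M (T.map (fun p => ((p.1 + p.2.1) / 2, p.2.2))) := by
  induction T using Quotient.inductionOn with
  | h l =>
  simp only [Multiset.quot_mk_to_coe, Multiset.map_coe] at *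
  rw [NN_coe g _ h1, NN_coe g _ h2, NN_coe g _ h3]
  have := g.hconc (l.map (fun p => p.1)) (l.map (fun p => p.2.1)) (l.map (fun p => p.2.2))
    (by simp) (by simp) (by simpa using h1.ne)
    (by simpa [Function.comp_def] using h1.en) (by simpa [Function.comp_def] using h2.en)
    (by simpa [Function.comp_def] using h1.wt)
  simp only [List.zipWith_map, List.map_map, Function.comp_def] at this ⊢
  simpa using this

theorem mid_concave (f : ℝ → ℝ) (B : ℝ) (hB : ∀ t, 0 ≤ t → t ≤ 1 → |f t| ≤ B)
    (hf : ∀ t t', 0 ≤ t → t ≤ 1 → 0 ≤ t' → t' ≤ 1 → (f t + f t') / 2 ≤ f ((t + t') / 2))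
    (t : ℝ) (h0 : 0 ≤ t) (h1 : t ≤ 1) : (1 - t) * f 0 + t * f 1 ≤ f t := by
  have b0 := abs_le.1 (hB 0 le_rfl zero_le_one)
  have b1 := abs_le.1 (hB 1 zero_le_one le_rfl)
  have key : ∀ n : ℕ, ∀ t, 0 ≤ t → t ≤ 1 → (1 - t) * f 0 + t * f 1 - f t ≤ 2 * B * (1/2)^n := by
    intro n
    induction n with
    | zero =>
      intro t h0 h1
      have := abs_le.1 (hB t h0 h1)
      simp only [pow_zero, mul_one]
      nlinarith
    | succ n ih =>
      intro t h0 h1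
      rw [pow_succ]
      rcases le_total t (1/2) with h | h
      · have i := ih (2*t) (by linarith) (by linarith)
        have j := hf 0 (2*t) le_rfl zero_le_one (by linarith) (by linarith)
        have e : (0 + 2*t)/2 = t := by ring
        rw [e] at j
        linarith
      · have i := ih (2*t-1) (by linarith) (by linarith)
        have j := hf 1 (2*t-1) zero_le_one le_rfl (by linarith) (by linarith)
        have e : (1 + (2*t-1))/2 = t := by ring
        rw [e] at j
        linarith
  have lim : Filter.Tendsto (fun n : ℕ => 2 * B * (1/2:ℝ)^n) Filter.atTop (nhds (2 * B * 0)) :=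
    (tendsto_pow_atTop_nhds_zero_of_lt_one (by norm_num) (by norm_num)).const_mul _
  have := ge_of_tendsto' lim (fun n => key n t h0 h1)
  linarith

theorem exists_bd (T : Multiset ℝ) : ∃ B, ∀ y ∈ T, |y| ≤ B := by
  induction T using Multiset.induction_on with
  | empty => exact ⟨0, by simp⟩
  | cons y T ih =>
    obtain ⟨B, hB⟩ := ih
    refine ⟨max |y| B, ?_⟩
    intro z hz
    rcases Multiset.mem_cons.1 hz with rfl | hz
    · exact le_max_left _ _
    · exact (hB z hz).trans (le_max_right _ _)

theorem VV_mix (hI : Convex ℝ I) (T : Multiset (ℝ × ℝ × ℝ))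
    (h1 : VV I (T.map (fun p => (p.1, p.2.2)))) (h2 : VV I (T.map (fun p => (p.2.1, p.2.2))))
    (t : ℝ) (h0 : 0 ≤ t) (ht : t ≤ 1) :
    VV I (T.map (fun p => ((1 - t) * p.1 + t * p.2.1, p.2.2))) := by
  refine ⟨?_, by simpa [VV, Function.comp_def] using h1.2⟩
  intro q hq
  obtain ⟨p, hp, rfl⟩ := Multiset.mem_map.1 hq
  have a := h1.1 _ (Multiset.mem_map_of_mem _ hp)
  have b := h2.1 _ (Multiset.mem_map_of_mem _ hp)
  exact ⟨hI a.1 b.1 (by linarith) h0 (by ring), a.2⟩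

theorem NN_conc (g : GoodMean I M) (T : Multiset (ℝ × ℝ × ℝ))
    (h1 : VV I (T.map (fun p => (p.1, p.2.2)))) (h2 : VV I (T.map (fun p => (p.2.1, p.2.2))))
    (t : ℝ) (h0 : 0 ≤ t) (ht : t ≤ 1) :
    (1 - t) * NN M (T.map (fun p => (p.1, p.2.2))) + t * NN M (T.map (fun p => (p.2.1, p.2.2))) ≤
      NN M (T.map (fun p => ((1 - t) * p.1 + t * p.2.1, p.2.2))) := by
  obtain ⟨B1, hB1⟩ := exists_bd (T.map (fun p => p.1))
  obtain ⟨B2, hB2⟩ := exists_bd (T.map (fun p => p.2.1))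
  have := mid_concave (fun t => NN M (T.map (fun p => ((1 - t) * p.1 + t * p.2.1, p.2.2))))
    (max B1 B2) ?_ ?_ t h0 ht
  · simpa using this
  · intro t h0 ht
    apply NN_bdd g _ (VV_mix g.hI T h1 h2 t h0 ht)
    intro q hq
    obtain ⟨p, hp, rfl⟩ := Multiset.mem_map.1 hq
    have a := abs_le.1 ((hB1 _ (Multiset.mem_map_of_mem _ hp)).trans (le_max_left B1 B2))
    have b := abs_le.1 ((hB2 _ (Multiset.mem_map_of_mem _ hp)).trans (le_max_right B1 B2))
    apply abs_le.2
    constructor <;> nlinarith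
  · intro t t' h0 ht h0' ht'
    have v1 := VV_mix g.hI T h1 h2 t h0 ht
    have v2 := VV_mix g.hI T h1 h2 t' h0' ht'
    have v3 := VV_mix g.hI T h1 h2 ((t + t')/2) (by linarith) (by linarith)
    have e : ∀ p : ℝ × ℝ × ℝ, ((1 - t) * p.1 + t * p.2.1 + ((1 - t') * p.1 + t' * p.2.1)) / 2
      = (1 - (t + t')/2) * p.1 + (t + t')/2 * p.2.1 := by intro p; ring
    have := NN_mid g (T.map (fun p => ((1 - t) * p.1 + t * p.2.1, (1 - t') * p.1 + t' * p.2.1, p.2.2)))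
      (by simpa [Function.comp_def] using v1) (by simpa [Function.comp_def] using v2)
      (by simpa only [Multiset.map_map, Function.comp_def, e] using v3)
    simpa only [Multiset.map_map, Function.comp_def, e] using this


theorem VV.cons2 {S : Multiset (ℝ × ℝ)} {y z a b : ℝ} (hS : ∀ p ∈ S, p.1 ∈ I ∧ 0 ≤ p.2)
    (hy : y ∈ I) (hz : z ∈ I) (ha : 0 ≤ a) (hb : 0 ≤ b) (hab : 0 < a + b) :
    VV I ((y, a) ::ₘ (z, b) ::ₘ S) := by
  have hSs : 0 ≤ (S.map Prod.snd).sum := Multiset.sum_nonneg (by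
    intro w hw
    obtain ⟨p, hp, rfl⟩ := Multiset.mem_map.1 hw
    exact (hS p hp).2)
  refine ⟨?_, by simp; linarith⟩
  intro p hp
  simp only [Multiset.mem_cons] at hp
  rcases hp with rfl | rfl | hp
  · exact ⟨hy, ha⟩
  · exact ⟨hz, hb⟩
  · exact hS p hp

theorem VV.cons1 {S : Multiset (ℝ × ℝ)} {y a : ℝ} (hS : ∀ p ∈ S, p.1 ∈ I ∧ 0 ≤ p.2)
    (hy : y ∈ I) (ha : 0 < a) : VV I ((y, a) ::ₘ S) := by
  have hSs : 0 ≤ (S.map Prod.snd).sum := Multiset.sum_nonneg (by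
    intro w hw
    obtain ⟨p, hp, rfl⟩ := Multiset.mem_map.1 hw
    exact (hS p hp).2)
  refine ⟨?_, by simp; linarith⟩
  intro p hp
  simp only [Multiset.mem_cons] at hp
  rcases hp with rfl | hp
  · exact ⟨hy, ha.le⟩
  · exact hS p hp

theorem midI (hI : Convex ℝ I) {u v : ℝ} (hu : u ∈ I) (hv : v ∈ I) : (u + v) / 2 ∈ I := by
  have := hI hu hv (a := 1/2) (b := 1/2) (by norm_num) (by norm_num) (by norm_num)
  simp only [smul_eq_mul] at this
  convert this using 1
  ring

theorem step1 (g : GoodMean I M) (S : Multiset (ℝ × ℝ)) (hS : ∀ p ∈ S, p.1 ∈ I ∧ 0 ≤ p.2)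
    (u v a b : ℝ) (hu : u ∈ I) (hv : v ∈ I) (hb : 0 ≤ b) (hab : b ≤ a) (hs : 0 < a + b) :
    NN M ((u, a) ::ₘ (v, b) ::ₘ S) ≤ NN M (((u + v) / 2, 2 * b) ::ₘ (u, a - b) ::ₘ S) := by
  have hw := midI g.hI hu hv
  have v0 := VV.cons2 hS hu hv (by linarith) hb hs
  have hS1 : ∀ p ∈ (u, a - b) ::ₘ S, p.1 ∈ I ∧ 0 ≤ p.2 := by
    intro p hp
    rcases Multiset.mem_cons.1 hp with rfl | hp
    · exact ⟨hu, by simpa using hab⟩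
    · exact hS p hp
  have v2 := VV.cons2 hS hw hu (a := 2 * b) (b := a - b) (by linarith) (by linarith) (by linarith)
  have e1 : NN M ((u, a) ::ₘ (v, b) ::ₘ S) = NN M ((u, b) ::ₘ (v, b) ::ₘ (u, a - b) ::ₘ S) := by
    have := NN_split g ((v, b) ::ₘ S) u b (a - b) hb (by linarith) (by
      rw [add_sub_cancel]; exact v0)
    rw [add_sub_cancel] at this
    rw [this, Multiset.cons_swap (u, a - b)]
  have e2 : NN M (((u + v) / 2, 2 * b) ::ₘ (u, a - b) ::ₘ S) =
      NN M (((u + v) / 2, b) ::ₘ ((u + v) / 2, b) ::ₘ (u, a - b) ::ₘ S) := by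
    have := NN_split g ((u, a - b) ::ₘ S) ((u + v) / 2) b b hb hb (by
      rw [← two_mul]; exact v2)
    rwa [← two_mul] at this
  rw [e1, e2]
  rcases hb.eq_or_lt with rfl | hb'
  · have va : VV I ((u, a - 0) ::ₘ S) := VV.cons1 hS hu (by linarith)
    rw [NN_zero g _ _ (va.cons hv le_rfl) hu, NN_zero g _ _ va hv,
      NN_zero g _ _ (va.cons hw le_rfl) hw, NN_zero g _ _ va hw]
  have m1 := VV.cons2 hS1 hu hv hb hb (by linarith)
  have m2 := VV.cons2 hS1 hv hu hb hb (by linarith)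
  have m3 := VV.cons2 hS1 hw hw hb hb (by linarith)
  have key := NN_mid g ((u, v, b) ::ₘ (v, u, b) ::ₘ (((u, a - b) ::ₘ S).map (fun p => (p.1, p.1, p.2))))
  have eS : S.map (fun p : ℝ × ℝ => (p.1, p.2)) = S := by simp
  simp only [Multiset.map_cons, Multiset.map_map, Function.comp_def, add_self_div_two, eS,
    add_comm v u] at key
  have := key m1 m2 m3
  rw [Multiset.cons_swap (v, b) (u, b)] at this
  linarith

theorem step2 (g : GoodMean I M) (S : Multiset (ℝ × ℝ)) (hS : ∀ p ∈ S, p.1 ∈ I ∧ 0 ≤ p.2)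
    (s c : ℝ) (hs : 0 < s) (u v a b : ℝ) (hu : u ∈ I) (hv : v ∈ I) (ha : 0 ≤ a) (hb : 0 ≤ b)
    (hab : a + b = s) (hc : a * u + b * v = s * c) :
    ∃ u' v' a' b', u' ∈ I ∧ v' ∈ I ∧ 0 ≤ a' ∧ 0 ≤ b' ∧ a' + b' = s ∧ a' * u' + b' * v' = s * c ∧
      |u' - v'| = |u - v| / 2 ∧
      NN M ((u, a) ::ₘ (v, b) ::ₘ S) ≤ NN M ((u', a') ::ₘ (v', b') ::ₘ S) := by
  rcases le_total b a with h | h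
  · refine ⟨(u + v) / 2, u, 2 * b, a - b, midI g.hI hu hv, hu, by linarith, by linarith,
      by linarith, by linarith, ?_, step1 g S hS u v a b hu hv hb h (by linarith)⟩
    rw [show (u + v) / 2 - u = -((u - v) / 2) by ring, abs_neg, abs_div]
    norm_num
  · refine ⟨(v + u) / 2, v, 2 * a, b - a, midI g.hI hv hu, hv, by linarith, by linarith,
      by linarith, by linarith, ?_, ?_⟩
    · rw [show (v + u) / 2 - v = (u - v) / 2 by ring, abs_div]
      norm_num
    · rw [Multiset.cons_swap]
      exact step1 g S hS v u b a hv hu ha h (by linarith)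

theorem stepn (g : GoodMean I M) (S : Multiset (ℝ × ℝ)) (hS : ∀ p ∈ S, p.1 ∈ I ∧ 0 ≤ p.2)
    (s c : ℝ) (hs : 0 < s) (u v a b : ℝ) (hu : u ∈ I) (hv : v ∈ I) (ha : 0 ≤ a) (hb : 0 ≤ b)
    (hab : a + b = s) (hc : a * u + b * v = s * c) (n : ℕ) :
    ∃ u' v' a' b', u' ∈ I ∧ v' ∈ I ∧ 0 ≤ a' ∧ 0 ≤ b' ∧ a' + b' = s ∧ a' * u' + b' * v' = s * c ∧
      |u' - v'| = |u - v| * (1 / 2) ^ n ∧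
      NN M ((u, a) ::ₘ (v, b) ::ₘ S) ≤ NN M ((u', a') ::ₘ (v', b') ::ₘ S) := by
  induction n with
  | zero => exact ⟨u, v, a, b, hu, hv, ha, hb, hab, hc, by simp, le_rfl⟩
  | succ n ih =>
    obtain ⟨u1, v1, a1, b1, hu1, hv1, ha1, hb1, hab1, hc1, hd, hN⟩ := ih
    obtain ⟨u2, v2, a2, b2, hu2, hv2, ha2, hb2, hab2, hc2, hd2, hN2⟩ :=
      step2 g S hS s c hs u1 v1 a1 b1 hu1 hv1 ha1 hb1 hab1 hc1
    exact ⟨u2, v2, a2, b2, hu2, hv2, ha2, hb2, hab2, hc2, by rw [hd2, hd, pow_succ]; ring,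
      hN.trans hN2⟩

theorem dist_c {s c u v a b : ℝ} (hs : 0 < s) (ha : 0 ≤ a) (hb : 0 ≤ b)
    (hab : a + b = s) (hc : a * u + b * v = s * c) : |c - u| ≤ |u - v| := by
  have e : s * (c - u) = b * (v - u) := by rw [mul_sub, ← hc, ← hab]; ring
  have e2 : s * |c - u| = b * |u - v| := by
    rw [abs_sub_comm u v, ← abs_of_pos hs, ← abs_mul, e, abs_mul, abs_of_nonneg hb]
  have : b * |u - v| ≤ s * |u - v| := mul_le_mul_of_nonneg_right (by linarith) (abs_nonneg _)
  rw [← e2] at this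
  exact le_of_mul_le_mul_left this hs

theorem near_I (hI : Convex ℝ I) {u v a b s c : ℝ} (hu : u ∈ I) (hv : v ∈ I) (ha : 0 < a) (hb : 0 < b)
    (huv : u ≠ v) (hab : a + b = s) (hc : a * u + b * v = s * c) :
    ∃ δ > 0, ∀ z, |z - c| ≤ δ → z ∈ I := by
  have hs : 0 < s := by linarith
  have h1 : s * (c - u) = b * (v - u) := by rw [mul_sub, ← hc, ← hab]; ring
  have h2 : s * (v - c) = a * (v - u) := by rw [mul_sub, ← hc, ← hab]; ring
  have hO := hI.ordConnected
  rcases lt_or_gt_of_ne huv with h | h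
  · have p1 : 0 < c - u := by
      have : 0 < s * (c - u) := by rw [h1]; exact mul_pos hb (by linarith)
      exact (pos_iff_pos_of_mul_pos this).1 hs
    have p2 : 0 < v - c := by
      have : 0 < s * (v - c) := by rw [h2]; exact mul_pos ha (by linarith)
      exact (pos_iff_pos_of_mul_pos this).1 hs
    refine ⟨min (c - u) (v - c), lt_min p1 p2, fun z hz => hO.out hu hv ?_⟩
    have i1 := abs_le.1 (hz.trans (min_le_left _ _))
    have i2 := abs_le.1 (hz.trans (min_le_right _ _))
    exact ⟨by linarith, by linarith⟩
  · have p1 : 0 < u - c := by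
      have : 0 < s * (u - c) := by
        have := mul_pos hb (sub_pos.2 h)
        nlinarith
      exact (pos_iff_pos_of_mul_pos this).1 hs
    have p2 : 0 < c - v := by
      have : 0 < s * (c - v) := by
        have := mul_pos ha (sub_pos.2 h)
        nlinarith
      exact (pos_iff_pos_of_mul_pos this).1 hs
    refine ⟨min (u - c) (c - v), lt_min p1 p2, fun z hz => hO.out hv hu ?_⟩
    have i1 := abs_le.1 (hz.trans (min_le_left _ _))
    have i2 := abs_le.1 (hz.trans (min_le_right _ _))
    exact ⟨by linarith, by linarith⟩

theorem two_point (g : GoodMean I M) (S : Multiset (ℝ × ℝ)) (hS : ∀ p ∈ S, p.1 ∈ I ∧ 0 ≤ p.2)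
    (u v a b c : ℝ) (hu : u ∈ I) (hv : v ∈ I) (ha : 0 ≤ a) (hb : 0 ≤ b) (hs : 0 < a + b)
    (hc : a * u + b * v = (a + b) * c) :
    NN M ((u, a) ::ₘ (v, b) ::ₘ S) ≤ NN M ((c, a + b) ::ₘ S) := by
  rcases ha.eq_or_lt with rfl | ha'
  · simp only [zero_add, zero_mul] at *
    have : v = c := mul_left_cancel₀ hs.ne' hc
    subst this
    rw [NN_zero g _ _ (VV.cons1 hS hv hs) hu]
  rcases hb.eq_or_lt with rfl | hb'
  · simp only [add_zero, zero_mul] at *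
    have : u = c := mul_left_cancel₀ hs.ne' hc
    subst this
    rw [Multiset.cons_swap, NN_zero g _ _ (VV.cons1 hS hu hs) hv]
  by_cases huv : u = v
  · subst huv
    have : u = c := by
      apply mul_left_cancel₀ hs.ne'
      rw [← hc]; ring
    subst this
    rw [NN_split g S u a b ha hb (VV.cons1 hS hu hs)]
  obtain ⟨δ, hδ, hz⟩ := near_I g.hI hu hv ha' hb' huv rfl hc
  have hcI : c ∈ I := hz c (by simpa using hδ.le)
  obtain ⟨B, hB⟩ := exists_bd (S.map Prod.fst)
  set B' : ℝ := max B (|c| + δ) with hB'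
  have hSB : ∀ p ∈ S, |p.1| ≤ B' := fun p hp =>
    (hB _ (Multiset.mem_map_of_mem _ hp)).trans (le_max_left _ _)
  have hzB : ∀ z, |z - c| ≤ δ → |z| ≤ B' := by
    intro z h
    have : |z| ≤ |z - c| + |c| := by
      have := abs_add_le (z - c) c
      simpa using this
    exact le_trans (by linarith) (le_max_right B (|c| + δ))
  have hB0 : 0 < B' := lt_of_lt_of_le (by have := abs_nonneg c; linarith) (le_max_right B (|c| + δ))
  apply le_of_forall_pos_le_add
  intro η hη
  -- choose ε
  obtain ⟨ε, hε0, hε1, hεη⟩ : ∃ ε : ℝ, 0 < ε ∧ ε ≤ 1 ∧ 2 * ε * B' ≤ η := by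
    refine ⟨min 1 (η / (2 * B')), lt_min one_pos (by positivity), min_le_left _ _, ?_⟩
    have := min_le_right 1 (η / (2 * B'))
    rw [le_div_iff₀ (by positivity)] at this
    linarith
  have huvp : 0 < |u - v| := abs_pos.2 (sub_ne_zero.2 huv)
  obtain ⟨n, hn⟩ := exists_pow_lt_of_lt_one (show 0 < ε * δ / |u - v| by positivity)
    (show (1/2 : ℝ) < 1 by norm_num)
  obtain ⟨u1, v1, a1, b1, hu1, hv1, ha1, hb1, hab1, hc1, hd, hN⟩ :=
      stepn g S hS (a + b) c hs u v a b hu hv ha hb rfl hc n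
  have hd' : |u1 - v1| ≤ ε * δ := by
    rw [hd]
    rw [lt_div_iff₀ huvp] at hn
    linarith
  have du : |c - u1| ≤ ε * δ := (dist_c hs ha1 hb1 hab1 hc1).trans hd'
  have dv : |c - v1| ≤ ε * δ := by
    refine (dist_c (a := b1) (b := a1) (v := u1) hs hb1 ha1 (by linarith) (by linarith)).trans ?_
    rw [abs_sub_comm]; exact hd'
  have zc : ∀ w, |c - w| ≤ ε * δ → |(c + (1 - ε) / ε * (c - w)) - c| ≤ δ := by
    intro w hw
    rw [add_sub_cancel_left, abs_mul, abs_of_nonneg (div_nonneg (by linarith) hε0.le)]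
    calc (1 - ε) / ε * |c - w| ≤ (1 / ε) * (ε * δ) := by
          apply mul_le_mul _ hw (abs_nonneg _) (by positivity)
          apply div_le_div_of_nonneg_right _ hε0.le
          linarith
      _ = δ := by field_simp
  have uB : |u1| ≤ B' := hzB _ (by rw [abs_sub_comm]; nlinarith)
  have vB : |v1| ≤ B' := hzB _ (by rw [abs_sub_comm]; nlinarith)
  set zu := c + (1 - ε) / ε * (c - u1) with hzu
  set zv := c + (1 - ε) / ε * (c - v1) with hzv
  have eu : (1 - ε) * u1 + ε * zu = c := by rw [hzu]; field_simp; ring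
  have ev : (1 - ε) * v1 + ε * zv = c := by rw [hzv]; field_simp; ring
  have V1 := VV.cons2 hS hu1 hv1 ha1 hb1 (by linarith)
  have V2 := VV.cons2 hS (hz _ (zc _ du)) (hz _ (zc _ dv)) ha1 hb1 (by linarith)
  have key := NN_conc g ((u1, zu, a1) ::ₘ (v1, zv, b1) ::ₘ (S.map (fun p => (p.1, p.1, p.2))))
  have eS : S.map (fun p : ℝ × ℝ => (p.1, p.2)) = S := by simp
  simp only [Multiset.map_cons, Multiset.map_map, Function.comp_def, eS] at key
  have key := key V1 V2 ε hε0.le hε1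
  have e3 : ∀ y : ℝ, (1 - ε) * y + ε * y = y := by intro y; ring
  simp only [e3, eS, eu, ev] at key
  have sp := NN_split g S c a1 b1 ha1 hb1 (VV.cons1 hS hcI (by linarith))
  rw [hab1] at sp
  rw [← sp] at key
  have bd : ∀ y z : ℝ, |y| ≤ B' → |z| ≤ B' → ∀ p ∈ (y, a1) ::ₘ (z, b1) ::ₘ S, |p.1| ≤ B' := by
    intro y z hy hz p hp
    simp only [Multiset.mem_cons] at hp
    rcases hp with rfl | rfl | hp
    · exact hy
    · exact hz
    · exact hSB p hp
  have n1 := abs_le.1 (NN_bdd g _ V1 B' (bd _ _ uB vB))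
  have n2 := abs_le.1 (NN_bdd g _ V2 B' (bd _ _ (hzB _ (zc _ du)) (hzB _ (zc _ dv))))
  nlinarith


theorem multi_le (g : GoodMean I M) (u v a b c : ℕ → ℝ) (s : Multiset ℕ)
    (hs : ∀ k ∈ s, u k ∈ I ∧ v k ∈ I ∧ c k ∈ I ∧ 0 ≤ a k ∧ 0 ≤ b k ∧ 0 < a k + b k ∧
      a k * u k + b k * v k = (a k + b k) * c k) :
    ∀ (S : Multiset (ℝ × ℝ)), (∀ p ∈ S, p.1 ∈ I ∧ 0 ≤ p.2) →
    NN M (S + s.map (fun k => (u k, a k)) + s.map (fun k => (v k, b k))) ≤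
      NN M (S + s.map (fun k => (c k, a k + b k))) := by
  induction s using Multiset.induction_on with
  | empty => intro S hS; simp
  | cons k s ih =>
    intro S hS
    obtain ⟨h1, h2, h3, h4, h5, h6, h7⟩ := hs k (by simp)
    have hs' := fun i (hi : i ∈ s) => hs i (Multiset.mem_cons_of_mem hi)
    have hA : ∀ p ∈ S + s.map (fun k => (u k, a k)) + s.map (fun k => (v k, b k)),
        p.1 ∈ I ∧ 0 ≤ p.2 := by
      intro p hp
      simp only [Multiset.mem_add, Multiset.mem_map] at hp
      rcases hp with (hp | ⟨i, hi, rfl⟩) | ⟨i, hi, rfl⟩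
      · exact hS p hp
      · exact ⟨(hs' i hi).1, (hs' i hi).2.2.2.1⟩
      · exact ⟨(hs' i hi).2.1, (hs' i hi).2.2.2.2.1⟩
    have t := two_point g _ hA (u k) (v k) (a k) (b k) (c k) h1 h2 h4 h5 h6 h7
    have r := ih hs' ((c k, a k + b k) ::ₘ S) (by
      intro p hp
      rcases Multiset.mem_cons.1 hp with rfl | hp
      · exact ⟨h3, h6.le⟩
      · exact hS p hp)
    simp only [Multiset.map_cons, Multiset.cons_add, Multiset.add_cons] at *
    rw [Multiset.cons_swap]
    exact t.trans r

theorem multi_merge (g : GoodMean I M) (u a b : ℕ → ℝ) (s : Multiset ℕ)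
    (hs : ∀ k ∈ s, u k ∈ I ∧ 0 ≤ a k ∧ 0 ≤ b k ∧ 0 < a k + b k) :
    ∀ (S : Multiset (ℝ × ℝ)), (∀ p ∈ S, p.1 ∈ I ∧ 0 ≤ p.2) →
    NN M (S + s.map (fun k => (u k, a k)) + s.map (fun k => (u k, b k))) =
      NN M (S + s.map (fun k => (u k, a k + b k))) := by
  induction s using Multiset.induction_on with
  | empty => intro S hS; simp
  | cons k s ih =>
    intro S hS
    obtain ⟨h1, h4, h5, h6⟩ := hs k (by simp)
    have hs' := fun i (hi : i ∈ s) => hs i (Multiset.mem_cons_of_mem hi)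
    have hA : ∀ p ∈ S + s.map (fun k => (u k, a k)) + s.map (fun k => (u k, b k)),
        p.1 ∈ I ∧ 0 ≤ p.2 := by
      intro p hp
      simp only [Multiset.mem_add, Multiset.mem_map] at hp
      rcases hp with (hp | ⟨i, hi, rfl⟩) | ⟨i, hi, rfl⟩
      · exact hS p hp
      · exact ⟨(hs' i hi).1, (hs' i hi).2.1⟩
      · exact ⟨(hs' i hi).1, (hs' i hi).2.2.1⟩
    have t := NN_split g _ (u k) (a k) (b k) h4 h5 (VV.cons1 hA h1 h6)
    have r := ih hs' ((u k, a k + b k) ::ₘ S) (by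
      intro p hp
      rcases Multiset.mem_cons.1 hp with rfl | hp
      · exact ⟨h1, h6.le⟩
      · exact hS p hp)
    simp only [Multiset.map_cons, Multiset.cons_add, Multiset.add_cons] at *
    rw [Multiset.cons_swap, ← t, r]

theorem VV_range {u w : ℕ → ℝ} {J : ℕ} (hJ : 0 < J) (h : ∀ i < J, u i ∈ I ∧ 0 < w i) :
    VV I ((Multiset.range J).map (fun i => (u i, w i))) := by
  obtain ⟨K, rfl⟩ : ∃ K, J = K + 1 := ⟨J - 1, by omega⟩
  rw [Multiset.range_succ, Multiset.map_cons]
  apply VV.cons1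
  · intro p hp
    obtain ⟨i, hi, rfl⟩ := Multiset.mem_map.1 hp
    have := h i (by have := Multiset.mem_range.1 hi; omega)
    exact ⟨this.1, this.2.le⟩
  · exact (h K (by omega)).1
  · exact (h K (by omega)).2

theorem NN_range (g : GoodMean I M) {u w : ℕ → ℝ} {J : ℕ} (hJ : 0 < J)
    (h : ∀ i < J, u i ∈ I ∧ 0 < w i) :
    NN M ((Multiset.range J).map (fun i => (u i, w i))) =
      M ((List.range J).map u) ((List.range J).map w) := by
  have e : (Multiset.range J).map (fun i => (u i, w i)) =
    (((List.range J).map (fun i => (u i, w i)) : List (ℝ × ℝ)) : Multiset (ℝ × ℝ)) := rfl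
  have v := VV_range hJ h
  rw [e] at *
  rw [NN_coe g _ v]
  simp [Function.comp_def]

theorem range_shift (f : ℕ → ℝ × ℝ) (J : ℕ) : (Multiset.range (J+1)).map f =
    f 0 ::ₘ (Multiset.range J).map (fun i => f (i+1)) := by
  induction J with
  | zero => simp
  | succ J ih =>
    rw [Multiset.range_succ, Multiset.map_cons, ih, Multiset.range_succ, Multiset.map_cons,
      Multiset.cons_swap]

theorem core (g : GoodMean I M) (J : ℕ) (hJ : 0 < J) (x lam L m : ℕ → ℝ)
    (hx : ∀ i < J + 1, x (i+1) ∈ I) (hm : ∀ i < J + 1, m (i+1) ∈ I)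
    (hlam : ∀ i < J + 1, 0 < lam (i+1)) (L0 : L 0 = 0) (hL : ∀ i, L (i+1) = L i + lam (i+1))
    (hLp : ∀ i < J + 1, 0 < L (i+1))
    (hmm : ∀ i < J + 1, L (i+1) * m (i+1) = L i * m i + lam (i+1) * x (i+1))
    (hr : ∀ i < J + 1, L i * L (J+1) ≤ L (i+1) * L J) :
    L J * M ((List.range J).map fun i => m (i + 1)) ((List.range J).map fun i => lam (i + 1))
      + lam (J+1) * M ((List.range (J+1)).map fun i => x (i + 1))
            ((List.range (J+1)).map fun i => lam (i + 1))
        ≤ L (J+1) * M ((List.range (J+1)).map fun i => m (i + 1))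
            ((List.range (J+1)).map fun i => lam (i + 1)) := by
  have LJ : 0 < L J := by
    have := hLp (J-1) (by omega)
    rwa [Nat.sub_add_cancel hJ] at this
  have LJ1 := hLp J (by omega)
  have Lnn : ∀ i < J + 1, 0 ≤ L i := by
    intro i hi
    rcases i with _ | i
    · exact L0.ge
    · exact (hLp i (by omega)).le
  have hlJ := hlam J (by omega)
  set α : ℕ → ℝ := fun i => L (i+1) - L i * L (J+1) / L J with hα
  set β : ℕ → ℝ := fun i => L i * lam (J+1) / L J with hβ
  set v : ℕ → ℝ := fun i => if i = 0 then m 1 else m i with hv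
  set c : ℕ → ℝ := fun i => (α i * m (i+1) + β i * v i) / lam (i+1) with hc
  have hαβ : ∀ i, α i + β i = lam (i+1) := by
    intro i
    simp only [hα, hβ]
    rw [hL J, hL i]
    field_simp
    ring
  have hα0 : ∀ i < J + 1, 0 ≤ α i := by
    intro i hi
    simp only [hα]
    rw [sub_nonneg, div_le_iff₀ LJ]
    exact hr i hi
  have hβ0 : ∀ i < J + 1, 0 ≤ β i := fun i hi =>
    div_nonneg (mul_nonneg (Lnn i hi) hlJ.le) LJ.le
  have hvI : ∀ i < J + 1, v i ∈ I := by
    intro i hi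
    rcases i with _ | i
    · exact hm 0 hi
    · exact hm i (by omega)
  have hLv : ∀ i, L i * v i = L i * m i := by
    intro i
    rcases i with _ | i
    · simp [L0]
    · simp [hv]
  have hcI : ∀ i < J + 1, c i ∈ I := by
    intro i hi
    have l := hlam i hi
    have := g.hI (hm i hi) (hvI i hi) (div_nonneg (hα0 i hi) l.le) (div_nonneg (hβ0 i hi) l.le)
      (by rw [← add_div, hαβ, div_self l.ne'])
    convert this using 1
    simp only [hc, smul_eq_mul]
    ring
  -- averaging
  have A1 := multi_le g (fun i => m (i+1)) v α β c (Multiset.range (J+1)) (by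
    intro k hk
    have hk := Multiset.mem_range.1 hk
    have l := hlam k hk
    refine ⟨hm k hk, hvI k hk, hcI k hk, hα0 k hk, hβ0 k hk, by rw [hαβ]; exact l, ?_⟩
    rw [hαβ]
    simp only [hc]
    field_simp) 0 (by simp)
  simp only [zero_add, hαβ] at A1
  -- left side
  have hαJ : α J = 0 := by simp only [hα]; field_simp; ring
  have hβz : β 0 = 0 := by simp [hβ, L0]
  have hsum : ∀ i, α i + β (i+1) = L (J+1) / L J * lam (i+1) := by
    intro i
    simp only [hα, hβ]
    rw [hL J, hL i]
    field_simp
    ring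
  have hsp : ∀ i < J, 0 < α i + β (i+1) := by
    intro i hi
    rw [hsum]
    exact mul_pos (div_pos LJ1 LJ) (hlam i (by omega))
  have B1 := multi_merge g (fun i => m (i+1)) α (fun i => β (i+1)) (Multiset.range J) (by
    intro k hk
    have hk := Multiset.mem_range.1 hk
    exact ⟨hm k (by omega), hα0 k (by omega), hβ0 (k+1) (by omega), hsp k hk⟩) 0 (by simp)
  simp only [zero_add, hsum] at B1
  have VB : VV I ((Multiset.range J).map (fun k => (m (k+1), α k)) +
      (Multiset.range J).map (fun k => (m (k+1), β (k+1)))) := by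
    constructor
    · intro p hp
      simp only [Multiset.mem_add, Multiset.mem_map, Multiset.mem_range] at hp
      rcases hp with ⟨i, hi, rfl⟩ | ⟨i, hi, rfl⟩
      · exact ⟨hm i (by omega), hα0 i (by omega)⟩
      · exact ⟨hm i (by omega), hβ0 (i+1) (by omega)⟩
    · simp only [Multiset.map_add, Multiset.map_map, Function.comp_def, Multiset.sum_add]
      rw [← Multiset.sum_map_add]
      have := (VV_range (I := I) (u := fun i => m (i+1)) (w := fun i => α i + β (i+1)) hJ
        (fun i hi => ⟨hm i (by omega), hsp i hi⟩)).2
      simpa only [Multiset.map_map, Function.comp_def] using this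
  have C1 : NN M ((Multiset.range (J+1)).map (fun k => (m (k+1), α k)) +
      (Multiset.range (J+1)).map (fun k => (v k, β k))) =
      NN M ((Multiset.range J).map (fun k => (m (k+1), α k)) +
      (Multiset.range J).map (fun k => (m (k+1), β (k+1)))) := by
    rw [range_shift (fun k => (v k, β k)), Multiset.range_succ, Multiset.map_cons, hαJ, hβz,
      Multiset.cons_add, Multiset.add_cons]
    have ev : ∀ i, v (i+1) = m (i+1) := by intro i; simp [hv]
    simp only [ev]
    rw [NN_zero g _ _ (VB.cons (hvI 0 (by omega)) le_rfl) (hm J (by omega)),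
      NN_zero g _ _ VB (hvI 0 (by omega))]
  rw [C1, B1, NN_range g hJ (u := fun i => m (i+1)) (w := fun i => L (J+1) / L J * lam (i+1))
    (fun i hi => ⟨hm i (by omega), mul_pos (div_pos LJ1 LJ) (hlam i (by omega))⟩)] at A1
  have VJ := VV_range (I := I) hJ (u := fun i => m (i+1)) (w := fun i => lam (i+1))
    (fun i hi => ⟨hm i (by omega), hlam i (by omega)⟩)
  have H := g.hhom ((List.range J).map fun i => m (i+1)) ((List.range J).map fun i => lam (i+1))
    (L (J+1) / L J) (div_pos LJ1 LJ) (by simp)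
    (by
      intro a ha
      obtain ⟨i, hi, rfl⟩ := List.mem_map.1 ha
      exact hm i (by have := List.mem_range.1 hi; omega))
    (by
      have := VV.wt (I := I) (l := (List.range J).map (fun i => (m (i+1), lam (i+1)))) VJ
      simpa only [List.map_map, Function.comp_def] using this)
  simp only [List.map_map, Function.comp_def] at H
  rw [H] at A1
  -- concavity
  have Vc := VV_range (I := I) (Nat.succ_pos J) (u := c) (w := fun i => lam (i+1))
    (fun i hi => ⟨hcI i hi, hlam i hi⟩)
  have Vx := VV_range (I := I) (Nat.succ_pos J) (u := fun i => x (i+1)) (w := fun i => lam (i+1))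
    (fun i hi => ⟨hx i hi, hlam i hi⟩)
  have K := NN_conc g ((Multiset.range (J+1)).map (fun i => (c i, x (i+1), lam (i+1))))
  simp only [Multiset.map_map, Function.comp_def] at K
  have K := K Vc Vx (lam (J+1) / L (J+1)) (div_nonneg hlJ.le LJ1.le) (by
    rw [div_le_one LJ1, hL J]; linarith)
  have e : (Multiset.range (J+1)).map (fun i => ((1 - lam (J+1) / L (J+1)) * c i +
      lam (J+1) / L (J+1) * x (i+1), lam (i+1))) =
      (Multiset.range (J+1)).map (fun i => (m (i+1), lam (i+1))) := by
    apply Multiset.map_congr rfl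
    intro i hi
    have hi := Multiset.mem_range.1 hi
    congr 1
    have l := hlam i hi
    have q := hmm i hi
    have q2 := hLv i
    have t : 1 - lam (J+1) / L (J+1) = L J / L (J+1) := by
      rw [hL J] at LJ1 ⊢
      field_simp
      ring
    have t2 : L J * lam (i+1) * c i = (L (i+1) * L J - L i * L (J+1)) * m (i+1)
        + lam (J+1) * (L i * v i) := by
      simp only [hc, hα, hβ]
      field_simp
    rw [t, div_mul_eq_mul_div, div_mul_eq_mul_div, ← add_div, div_eq_iff LJ1.ne']
    apply mul_left_cancel₀ l.ne'
    have hLJ := hL J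
    have hLi := hL i
    rw [q2] at t2
    have q3 : L i * m i = L (i+1) * m (i+1) - lam (i+1) * x (i+1) := by linarith
    rw [q3, hLJ, hLi] at t2
    rw [hLJ]
    linear_combination t2
  rw [e, NN_range g (Nat.succ_pos J) (u := fun i => x (i+1)) (w := fun i => lam (i+1))
    (fun i hi => ⟨hx i hi, hlam i hi⟩), NN_range g (Nat.succ_pos J) (u := fun i => m (i+1))
    (w := fun i => lam (i+1)) (fun i hi => ⟨hm i hi, hlam i hi⟩)] at K
  have t : 1 - lam (J+1) / L (J+1) = L J / L (J+1) := by
    rw [hL J] at LJ1 ⊢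
    field_simp
    ring
  rw [t] at K
  have K2 := (mul_le_mul_of_nonneg_left A1 (div_nonneg LJ.le LJ1.le))
  have K3 := (add_le_add_left K2 _).trans K
  have K4 := mul_le_mul_of_nonneg_left K3 LJ1.le
  refine le_trans (le_of_eq ?_) K4
  field_simp

end

/-- The key inductive inequality for the weighted Kedlaya theorem:
for a symmetric, Jensen concave weighted mean `M` on an interval `I`
(over ℝ, continuous in the weights), if the ratio sequence `λ k / Λ k` is
nonincreasing and `m k` denotes the weighted arithmetic partial means, then
`Λ_{j-1} M(m₁,…,m_{j-1}) + λ_j M(x₁,…,x_j) ≤ Λ_j M(m₁,…,m_j)`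
for every `j ∈ {2,…,n}`. -/
theorem weighted_kedlaya_inductive_step
    (I : Set ℝ) (hI : Convex ℝ I) (M : List ℝ → List ℝ → ℝ)
    -- nullhomogeneity in the weights
    (hhom : ∀ (x lam : List ℝ) (t : ℝ), 0 < t → x.length = lam.length →
      (∀ a ∈ x, a ∈ I) → IsWeightVec lam → M x (lam.map (fun w => t * w)) = M x lam)
    -- reduction principle
    (hred : ∀ (x lam mu : List ℝ), x.length = lam.length → x.length = mu.length →
      (∀ a ∈ x, a ∈ I) → IsWeightVec lam → IsWeightVec mu →
      M x (List.zipWith (· + ·) lam mu) = M (shuffle x x) (shuffle lam mu))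
    -- mean value property
    (hmean : ∀ (x lam : List ℝ), x ≠ [] → x.length = lam.length →
      (∀ a ∈ x, a ∈ I) → IsWeightVec lam →
      (∃ a ∈ x, a ≤ M x lam) ∧ (∃ a ∈ x, M x lam ≤ a))
    -- elimination principle
    (helim : ∀ (x₁ x₂ lam₁ lam₂ : List ℝ) (a : ℝ),
      x₁.length = lam₁.length → x₂.length = lam₂.length →
      (∀ b ∈ x₁ ++ a :: x₂, b ∈ I) → IsWeightVec (lam₁ ++ 0 :: lam₂) →
      M (x₁ ++ a :: x₂) (lam₁ ++ 0 :: lam₂) = M (x₁ ++ x₂) (lam₁ ++ lam₂))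
    -- symmetry: invariance under simultaneous permutations of entries and weights
    (hsym : ∀ (x lam x' lam' : List ℝ), x.length = lam.length →
      (∀ a ∈ x, a ∈ I) → IsWeightVec lam →
      (x.zip lam).Perm (x'.zip lam') → M x lam = M x' lam')
    -- Jensen concavity in the entries
    (hconc : ∀ (x y lam : List ℝ), x.length = lam.length → y.length = lam.length →
      x ≠ [] → (∀ a ∈ x, a ∈ I) → (∀ a ∈ y, a ∈ I) → IsWeightVec lam →
      (M x lam + M y lam) / 2 ≤ M (List.zipWith (fun a b => (a + b) / 2) x y) lam)
    -- continuity in the weights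
    (hcw : ∀ (x : List ℝ), (∀ a ∈ x, a ∈ I) →
      ContinuousOn (fun w : Fin x.length → ℝ => M x (List.ofFn w))
        {w | (∀ i, 0 ≤ w i) ∧ 0 < ∑ i, w i})
    (n : ℕ) (hn : 2 ≤ n) (x lam : ℕ → ℝ)
    (hx : ∀ i ∈ Icc 1 n, x i ∈ I)
    (hlam : ∀ i ∈ Icc 1 n, 0 < lam i)
    (L : ℕ → ℝ) (hL : ∀ k, L k = ∑ i ∈ Icc 1 k, lam i)
    (hmono : ∀ k ∈ Icc 1 (n - 1), lam (k + 1) / L (k + 1) ≤ lam k / L k)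
    (m : ℕ → ℝ) (hm : ∀ k, m k = (∑ i ∈ Icc 1 k, lam i * x i) / L k) :
    ∀ j, 2 ≤ j → j ≤ n →
      L (j - 1) * M ((List.range (j - 1)).map fun i => m (i + 1))
          ((List.range (j - 1)).map fun i => lam (i + 1))
        + lam j * M ((List.range j).map fun i => x (i + 1))
            ((List.range j).map fun i => lam (i + 1))
        ≤ L j * M ((List.range j).map fun i => m (i + 1))
            ((List.range j).map fun i => lam (i + 1)) := by
  intro j hj2 hjn
  have g : GoodMean I M := ⟨hI, hhom, hred, hmean, helim, hsym, hconc⟩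
  obtain ⟨J, rfl⟩ : ∃ J, j = J + 1 := ⟨j - 1, by omega⟩
  rw [Nat.add_sub_cancel]
  have hlam' : ∀ i < n, 0 < lam (i+1) := fun i hi => hlam _ (by simp; omega)
  have hx' : ∀ i < n, x (i+1) ∈ I := fun i hi => hx _ (by simp; omega)
  have L0 : L 0 = 0 := by rw [hL]; simp
  have hLs : ∀ i, L (i+1) = L i + lam (i+1) := by
    intro i
    rw [hL, hL, Finset.sum_Icc_succ_top (by omega)]
  have hLp : ∀ i < n, 0 < L (i+1) := by
    intro i
    induction i with
    | zero => intro hi; rw [hLs, L0, zero_add]; exact hlam' 0 hi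
    | succ i ih =>
      intro hi
      have := ih (by omega)
      have := hlam' (i+1) hi
      rw [hLs]; linarith
  have hmm : ∀ i < n, L (i+1) * m (i+1) = L i * m i + lam (i+1) * x (i+1) := by
    intro i hi
    have hi1 := hLp i hi
    have e1 : L (i+1) * m (i+1) = ∑ k ∈ Icc 1 (i+1), lam k * x k := by
      rw [hm]; field_simp
    have e2 : L i * m i = ∑ k ∈ Icc 1 i, lam k * x k := by
      rcases i with _ | i
      · simp [L0]
      · have := hLp i (by omega)
        rw [hm]; field_simp
    rw [e1, e2, Finset.sum_Icc_succ_top (by omega)]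
  have hmI : ∀ i < n, m (i+1) ∈ I := by
    intro i
    induction i with
    | zero =>
      intro hi
      have h := hmm 0 hi
      have l := hlam' 0 hi
      rw [hLs, L0, zero_mul] at h
      simp only [zero_add] at h l
      have h' : m 1 = x 1 := mul_left_cancel₀ l.ne' h
      rw [zero_add, h']
      exact hx' 0 hi
    | succ i ih =>
      intro hi
      have p := hLp (i+1) hi
      have h := hmm (i+1) hi
      have := hI (ih (by omega)) (hx' (i+1) hi) (div_nonneg (hLp i (by omega)).le p.le)
        (div_nonneg (hlam' (i+1) hi).le p.le) (by rw [← add_div, ← hLs, div_self p.ne'])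
      convert this using 1
      simp only [smul_eq_mul]
      rw [div_mul_eq_mul_div, div_mul_eq_mul_div, ← add_div, ← h]
      field_simp
  have hr : ∀ d i, i + d < n → lam (i + d + 1) / L (i + d + 1) ≤ lam (i+1) / L (i+1) := by
    intro d i
    induction d with
    | zero => intro _; exact le_rfl
    | succ d ih =>
      intro hd
      exact (hmono (i + d + 1) (by simp; omega)).trans (ih (by omega))
  apply core g J (by omega) x lam L m (fun i hi => hx' i (by omega)) (fun i hi => hmI i (by omega))
    (fun i hi => hlam' i (by omega)) L0 hLs (fun i hi => hLp i (by omega))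
    (fun i hi => hmm i (by omega))
  intro i hi
  have h := hr (J - i) i (by omega)
  rw [show i + (J - i) = J by omega, div_le_div_iff₀ (hLp J (by omega)) (hLp i (by omega))] at h
  have e1 := hLs J
  have e2 := hLs i
  have e3 : L i = L (i+1) - lam (i+1) := by linarith
  have e4 : L J = L (J+1) - lam (J+1) := by linarith
  rw [e3, e4]
  linarith
end
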